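/- arXiv:1606.08937 — 4 statements merged into one kernel-verified Lean document; each statement's English description precedes it below -/
import Mathlib

section
/- Let m ≥ 0 be an integer and let p, q, γ > 0. Then ∫_0^∞ x^{−1} e^{−qx − p/x} J_m(γx) dx = 2 J_m(z₋) K_m(z₊), where z_± = √(2p)·(√(q²+γ²) ± q)^{1/2}. -/
open Real MeasureTheory

/-- Bessel function of the first kind of integer order, via Bessel's integral. -/
noncomputable def besselJ (m : ℤ) (x : ℝ) : ℝ :=
  (1 / Real.pi) * ∫ θ in (0:ℝ)..Real.pi, Real.cos ((m : ℝ) * θ - x * Real.sin θ)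

/-- Modified Bessel function of the second kind (real argument). -/
noncomputable def besselK (ν x : ℝ) : ℝ :=
  ∫ t in Set.Ioi (0:ℝ), Real.exp (-x * Real.cosh t) * Real.cosh (ν * t)

/-- Modified Bessel function of the second kind (complex argument). -/
noncomputable def besselKC (ν : ℝ) (z : ℂ) : ℂ :=
  ∫ t in Set.Ioi (0:ℝ), Complex.exp (-z * (Real.cosh t : ℂ)) * (Real.cosh (ν * t) : ℂ)

/-- The p-extended Riemann zeta function. -/
noncomputable def zetaP (p α : ℝ) : ℝ :=
  (1 / Real.Gamma α) *
    ∫ t in Set.Ioi (0:ℝ), t ^ (α - 1) * Real.exp (-p / t) / (Real.exp t - 1)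

/-- The p-extended Mathieu series. -/
noncomputable def mathieuS (μ p r : ℝ) : ℝ :=
  2 * ∑' n : ℕ, (-1 : ℝ) ^ n *
      (Real.Gamma (μ + n + 1) / (n.factorial * Real.Gamma (μ + 1))) *
      zetaP p (2 * μ + 2 * n + 1) * r ^ (2 * n)

lemma sq_div_two_le_exp_add_exp_neg (t : ℝ) : t ^ 2 / 2 ≤ Real.exp t + Real.exp (-t) := by
  rcases le_total 0 t with h | h
  · have := Real.quadratic_le_exp_of_nonneg h
    have := Real.exp_pos (-t)
    linarith
  · have := Real.quadratic_le_exp_of_nonneg (neg_nonneg.2 h)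
    have := Real.exp_pos t
    nlinarith

lemma integrable_exp_mul_sub_exp_add_exp_neg (r : ℝ) {δ : ℝ} (hδ : 0 < δ) :
    Integrable fun t : ℝ => Real.exp (r * t - δ * (Real.exp t + Real.exp (-t))) := by
  have h := (integrable_cexp_quadratic (b := ((δ / 2 : ℝ) : ℂ))
    (by rw [Complex.ofReal_re]; positivity) (r : ℂ) 0).norm
  refine h.mono' (by fun_prop) (.of_forall fun t => ?_)
  rw [Complex.norm_exp, Real.norm_of_nonneg (Real.exp_pos _).le, Real.exp_le_exp]
  have h1 : (-((δ / 2 : ℝ) : ℂ) * (t : ℂ) ^ 2 + r * t + 0).re = -(δ / 2) * t ^ 2 + r * t := by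
    norm_cast
    simp
  rw [h1]
  nlinarith [sq_div_two_le_exp_add_exp_neg t]

lemma norm_cexp_neg_mul_exp_add (A B : ℂ) (t : ℝ) :
    ‖Complex.exp (-(A * Complex.exp t + B * Complex.exp (-t)))‖ =
      Real.exp (-(A.re * Real.exp t + B.re * Real.exp (-t))) := by
  rw [Complex.norm_exp]
  norm_cast
  simp only [Complex.neg_re, Complex.add_re, Complex.re_mul_ofReal]

lemma norm_cexp_neg_mul_exp_add_le {A B : ℂ} {δ : ℝ} (hA : δ ≤ A.re) (hB : δ ≤ B.re) (t : ℝ) :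
    ‖Complex.exp (-(A * Complex.exp t + B * Complex.exp (-t)))‖ ≤
      Real.exp (0 * t - δ * (Real.exp t + Real.exp (-t))) := by
  rw [norm_cexp_neg_mul_exp_add, Real.exp_le_exp]
  nlinarith [Real.exp_pos t, Real.exp_pos (-t)]

lemma integrable_cexp_neg_mul_exp_add {A B : ℂ} (hA : 0 < A.re) (hB : 0 < B.re) :
    Integrable fun t : ℝ => Complex.exp (-(A * Complex.exp t + B * Complex.exp (-t))) :=
  (integrable_exp_mul_sub_exp_add_exp_neg 0 (lt_min hA hB)).mono' (by fun_prop)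
    (.of_forall fun t => norm_cexp_neg_mul_exp_add_le (min_le_left _ _) (min_le_right _ _) t)

/-- The derivative of the integral of `exp (-(A eᵗ + B e⁻ᵗ))` along `(A, B) ↦ (A eˢᶜ, B e⁻ˢᶜ)`
vanishes. -/
lemma hasDerivAt_integral_cexp_neg_mul_exp_add (A B c : ℂ) (s₀ : ℝ)
    (hA : 0 < (A * Complex.exp (s₀ * c)).re) (hB : 0 < (B * Complex.exp (-(s₀ * c))).re) :
    HasDerivAt (fun s : ℝ => ∫ t : ℝ, Complex.exp (-(A * Complex.exp (s * c) * Complex.exp t +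
      B * Complex.exp (-(s * c)) * Complex.exp (-t)))) 0 s₀ := by
  obtain ⟨δ, hδ, hδ'⟩ := exists_between (lt_min hA hB)
  obtain ⟨M, hM⟩ := exists_gt (max ‖A * Complex.exp (s₀ * c)‖ ‖B * Complex.exp (-(s₀ * c))‖)
  have hcA : Continuous fun s : ℝ => A * Complex.exp (s * c) := by fun_prop
  have hcB : Continuous fun s : ℝ => B * Complex.exp (-(s * c)) := by fun_prop
  let S : Set ℝ := {s | δ < (A * Complex.exp (s * c)).re} ∩ {s | δ < (B * Complex.exp (-(s * c))).re}
    ∩ {s | ‖A * Complex.exp (s * c)‖ < M} ∩ {s | ‖B * Complex.exp (-(s * c))‖ < M}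
  have hS : S ∈ nhds s₀ := by
    refine Filter.inter_mem (Filter.inter_mem (Filter.inter_mem ?_ ?_) ?_) ?_
    · exact (isOpen_lt continuous_const (Complex.continuous_re.comp hcA)).mem_nhds
        (hδ'.trans_le (min_le_left _ _))
    · exact (isOpen_lt continuous_const (Complex.continuous_re.comp hcB)).mem_nhds
        (hδ'.trans_le (min_le_right _ _))
    · exact (isOpen_lt hcA.norm continuous_const).mem_nhds ((le_max_left _ _).trans_lt hM)
    · exact (isOpen_lt hcB.norm continuous_const).mem_nhds ((le_max_right _ _).trans_lt hM)
  let F' : ℝ → ℝ → ℂ := fun s t => Complex.exp (-(A * Complex.exp (s * c) * Complex.exp t +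
      B * Complex.exp (-(s * c)) * Complex.exp (-t))) *
      (-(A * Complex.exp (s * c) * Complex.exp t - B * Complex.exp (-(s * c)) * Complex.exp (-t)))
  have hcF' (s : ℝ) : Continuous (F' s) := by fun_prop
  have hbound : ∀ s ∈ S, ∀ t : ℝ, ‖F' s t‖ ≤
      M * (Real.exp (1 * t - δ * (Real.exp t + Real.exp (-t))) +
        Real.exp (-1 * t - δ * (Real.exp t + Real.exp (-t)))) := by
    rintro s ⟨⟨⟨h1, h2⟩, h3⟩, h4⟩ t
    have e1 : ‖Complex.exp t‖ = Real.exp t := by simp [Complex.norm_exp]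
    have e2 : ‖Complex.exp (-t)‖ = Real.exp (-t) := by simp [Complex.norm_exp]
    have e3 (r : ℝ) : Real.exp (r * t - δ * (Real.exp t + Real.exp (-t))) =
        Real.exp (r * t) * Real.exp (0 * t - δ * (Real.exp t + Real.exp (-t))) := by
      rw [← Real.exp_add]; ring_nf
    rw [e3 1, e3 (-1), one_mul, neg_one_mul, norm_mul, norm_neg, ← add_mul, ← mul_assoc, mul_comm]
    refine mul_le_mul ?_ (norm_cexp_neg_mul_exp_add_le h1.le h2.le t) (norm_nonneg _)
      (mul_nonneg ((norm_nonneg _).trans h3.le) (by positivity))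
    refine (norm_sub_le _ _).trans ?_
    rw [norm_mul _ (Complex.exp t), norm_mul _ (Complex.exp (-t)), e1, e2, mul_add]
    exact add_le_add (mul_le_mul_of_nonneg_right h3.le (Real.exp_pos _).le)
      (mul_le_mul_of_nonneg_right h4.le (Real.exp_pos _).le)
  have key := hasDerivAt_integral_of_dominated_loc_of_deriv_le (μ := volume) (x₀ := s₀) (s := S)
    (F := fun (s t : ℝ) => Complex.exp (-(A * Complex.exp (s * c) * Complex.exp t +
      B * Complex.exp (-(s * c)) * Complex.exp (-t)))) (F' := fun s t => c * F' s t)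
    (bound := fun t => ‖c‖ * (M * (Real.exp (1 * t - δ * (Real.exp t + Real.exp (-t))) +
        Real.exp (-1 * t - δ * (Real.exp t + Real.exp (-t)))))) hS
    (.of_forall fun s => by fun_prop) (integrable_cexp_neg_mul_exp_add hA hB)
    (by fun_prop) (.of_forall fun t s hs => by
      rw [norm_mul]
      exact mul_le_mul_of_nonneg_left (hbound s hs t) (norm_nonneg _))
    ((((integrable_exp_mul_sub_exp_add_exp_neg 1 hδ).add
      (integrable_exp_mul_sub_exp_add_exp_neg (-1) hδ)).const_mul _).const_mul _)
    (.of_forall fun t s hs => by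
      have h1 : HasDerivAt (fun s : ℝ => (s : ℂ) * c) c s := by
        simpa using (Complex.ofRealCLM.hasDerivAt (x := s)).mul_const c
      refine ((((h1.cexp.const_mul A).mul_const (Complex.exp t)).add
        ((h1.neg.cexp.const_mul B).mul_const (Complex.exp (-t)))).neg).cexp.congr_deriv ?_
      simp only [F', Pi.neg_apply, Pi.add_apply]
      ring)
  have hF'int : Integrable (F' s₀) :=
    (((integrable_exp_mul_sub_exp_add_exp_neg 1 hδ).add
      (integrable_exp_mul_sub_exp_add_exp_neg (-1) hδ)).const_mul _).mono'
      (hcF' s₀).aestronglyMeasurable (.of_forall (hbound s₀ (mem_of_mem_nhds hS)))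
  have hzero : ∫ t, F' s₀ t = 0 := by
    refine integral_eq_zero_of_hasDerivAt_of_integrable (fun t => ?_) hF'int
      (integrable_cexp_neg_mul_exp_add hA hB)
    have h1 : HasDerivAt (fun t : ℝ => (t : ℂ)) 1 t := Complex.ofRealCLM.hasDerivAt (x := t)
    refine (((h1.cexp.const_mul (A * Complex.exp (s₀ * c))).add
        (h1.neg.cexp.const_mul (B * Complex.exp (-(s₀ * c))))).neg).cexp.congr_deriv ?_
    simp only [F', Pi.neg_apply, Pi.add_apply]
    ring
  have := key.2
  rwa [integral_const_mul, hzero, mul_zero] at this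

lemma re_mul_exp_pos {z w : ℂ} (hz : 0 < z.re) (hw : 0 < w.re) {s : ℝ} (hs : s ∈ Set.Icc (0:ℝ) 1) :
    0 < (z * Complex.exp (s * (Complex.log w - Complex.log z))).re := by
  have hz0 : z ≠ 0 := by rintro rfl; simp at hz
  nth_rw 1 [← Complex.exp_log hz0]
  rw [← Complex.exp_add, Complex.exp_re]
  refine mul_pos (Real.exp_pos _) (Real.cos_pos_of_mem_Ioo ?_)
  have him : (Complex.log z + s * (Complex.log w - Complex.log z)).im =
      (1 - s) * z.arg + s * w.arg := by
    simp [Complex.log_im]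
    ring
  rw [him]
  have h1 := abs_lt.1 (Complex.abs_arg_lt_pi_div_two_iff.2 (.inl hz))
  have h2 := abs_lt.1 (Complex.abs_arg_lt_pi_div_two_iff.2 (.inl hw))
  have := convex_Ioo (-(Real.pi / 2)) (Real.pi / 2) h1 h2 (sub_nonneg.2 hs.2) hs.1 (by ring)
  simpa using this

/-- The integral of `exp (-(A eᵗ + B e⁻ᵗ))` depends only on the product `A B`. -/
lemma integral_cexp_neg_mul_exp_add_congr {A B C D : ℂ} (hA : 0 < A.re) (hB : 0 < B.re)
    (hC : 0 < C.re) (hD : 0 < D.re) (h : A * B = C * D) :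
    ∫ t : ℝ, Complex.exp (-(A * Complex.exp t + B * Complex.exp (-t))) =
      ∫ t : ℝ, Complex.exp (-(C * Complex.exp t + D * Complex.exp (-t))) := by
  have ne {z : ℂ} (hz : 0 < z.re) : z ≠ 0 := by rintro rfl; simp at hz
  have log_mul' {z w : ℂ} (hz : 0 < z.re) (hw : 0 < w.re) :
      Complex.log (z * w) = Complex.log z + Complex.log w := by
    refine Complex.log_mul (ne hz) (ne hw) ?_
    have h1 := abs_lt.1 (Complex.abs_arg_lt_pi_div_two_iff.2 (.inl hz))
    have h2 := abs_lt.1 (Complex.abs_arg_lt_pi_div_two_iff.2 (.inl hw))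
    constructor <;> linarith [h1.1, h1.2, h2.1, h2.2]
  set c := Complex.log C - Complex.log A with hc
  have hc' : -c = Complex.log D - Complex.log B := by
    have := log_mul' hA hB
    rw [h, log_mul' hC hD] at this
    linear_combination -this
  have hd : ∀ s ∈ Set.Icc (0:ℝ) 1, HasDerivAt (fun s : ℝ => ∫ t : ℝ,
      Complex.exp (-(A * Complex.exp (s * c) * Complex.exp t +
        B * Complex.exp (-(s * c)) * Complex.exp (-t)))) 0 s := fun s hs =>
    hasDerivAt_integral_cexp_neg_mul_exp_add A B c s (re_mul_exp_pos hA hC hs) (by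
      rw [← mul_neg, hc']
      exact re_mul_exp_pos hB hD hs)
  have := constant_of_has_deriv_right_zero (fun s hs => (hd s hs).continuousAt.continuousWithinAt)
    (fun s hs => (hd s (Set.Ico_subset_Icc_self hs)).hasDerivWithinAt) 1 (by simp)
  simp only [Complex.ofReal_one, Complex.ofReal_zero, one_mul, zero_mul, neg_zero, Complex.exp_zero,
    mul_one] at this
  have eC : A * Complex.exp c = C := by
    rw [hc, Complex.exp_sub, Complex.exp_log (ne hC), Complex.exp_log (ne hA),
      mul_div_cancel₀ _ (ne hA)]
  have eD : B * Complex.exp (-c) = D := by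
    rw [hc', Complex.exp_sub, Complex.exp_log (ne hD), Complex.exp_log (ne hB),
      mul_div_cancel₀ _ (ne hB)]
  rw [eC, eD] at this
  exact this.symm

lemma ofReal_besselJ (m : ℤ) (x : ℝ) :
    (besselJ m x : ℂ) = 1 / (2 * Real.pi) *
      ∫ θ in -Real.pi..Real.pi, Complex.exp (Complex.I * (m * θ - x * Real.sin θ)) := by
  have hc : Continuous fun θ : ℝ => Complex.exp (Complex.I * (m * θ - x * Real.sin θ)) := by
    fun_prop
  have h0 : ∫ θ in -Real.pi..0, Complex.exp (Complex.I * (m * θ - x * Real.sin θ)) =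
      ∫ θ in (0:ℝ)..Real.pi, Complex.exp (-(m * θ - x * Real.sin θ) * Complex.I) := by
    have := intervalIntegral.integral_comp_neg (a := 0) (b := Real.pi)
      (fun θ : ℝ => Complex.exp (Complex.I * (m * θ - x * Real.sin θ)))
    rw [neg_zero] at this
    rw [← this]
    refine intervalIntegral.integral_congr fun θ _ => ?_
    simp only [Real.sin_neg, Complex.ofReal_neg]
    ring_nf
  rw [← intervalIntegral.integral_add_adjacent_intervals (b := 0) (hc.intervalIntegrable _ _)
    (hc.intervalIntegrable _ _), h0, ← intervalIntegral.integral_add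
    (Continuous.intervalIntegrable (by fun_prop) _ _) (hc.intervalIntegrable _ _)]
  have h2 : ∀ θ : ℝ, Complex.exp (-(m * θ - x * Real.sin θ) * Complex.I) +
      Complex.exp (Complex.I * (m * θ - x * Real.sin θ)) =
        2 * ((Real.cos ((m : ℝ) * θ - x * Real.sin θ) : ℝ) : ℂ) := fun θ => by
    rw [Complex.ofReal_cos, Complex.two_cos, add_comm]
    push_cast
    ring_nf
  simp_rw [h2]
  rw [intervalIntegral.integral_const_mul, intervalIntegral.integral_ofReal, besselJ]
  push_cast
  ring

/-- Shifting the contour in the generating integral of `besselJ`. -/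
lemma integral_cexp_sub_mul_sinh (m : ℤ) (a t : ℝ) :
    ∫ θ in -Real.pi..Real.pi, Complex.exp (m * (t + θ * Complex.I) -
      a / 2 * (Complex.exp (t + θ * Complex.I) - Complex.exp (-(t + θ * Complex.I)))) =
      2 * Real.pi * besselJ m a := by
  let f : ℂ → ℂ := fun z => Complex.exp (m * z - a / 2 * (Complex.exp z - Complex.exp (-z)))
  have hper (z : ℂ) : f (z + Real.pi * Complex.I) = f (z + (-Real.pi : ℝ) * Complex.I) := by
    have h : z + Real.pi * Complex.I = z + (-Real.pi : ℝ) * Complex.I + 2 * Real.pi * Complex.I := by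
      push_cast; ring
    have h1 (w : ℂ) : f (w + 2 * Real.pi * Complex.I) = f w := by
      have e1 : Complex.exp (w + 2 * Real.pi * Complex.I) = Complex.exp w :=
        Complex.exp_periodic w
      have e2 : Complex.exp (-(w + 2 * Real.pi * Complex.I)) = Complex.exp (-w) := by
        rw [Complex.exp_neg, e1, Complex.exp_neg]
      simp only [f]
      rw [e1, e2, Complex.exp_eq_exp_iff_exists_int]
      exact ⟨m, by ring⟩
    rw [h, h1]
  have hrect := Complex.integral_boundary_rect_eq_zero_of_differentiableOn f
    (((-Real.pi : ℝ) : ℂ) * Complex.I) (t + Real.pi * Complex.I)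
    (Differentiable.differentiableOn (by fun_prop))
  simp only [Complex.add_re, Complex.add_im, Complex.ofReal_re, Complex.ofReal_im,
    Complex.re_ofReal_mul, Complex.im_ofReal_mul, Complex.I_re, Complex.I_im, mul_zero, mul_one,
    zero_add, add_zero, hper, sub_self, sub_eq_zero, Complex.ofReal_zero] at hrect
  refine (smul_right_injective ℂ Complex.I_ne_zero hrect).trans ?_
  have hpi : (Real.pi : ℂ) ≠ 0 := by exact_mod_cast Real.pi_ne_zero
  rw [ofReal_besselJ, ← mul_assoc, mul_one_div_cancel (mul_ne_zero two_ne_zero hpi), one_mul]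
  refine intervalIntegral.integral_congr fun θ _ => ?_
  simp only [f]
  congr 1
  rw [Complex.ofReal_sin, Complex.sin, ← neg_mul]
  linear_combination (a * (Complex.exp (-θ * Complex.I) - Complex.exp (θ * Complex.I)) / 2) *
    Complex.I_sq

lemma integral_mul_integral_cexp_swap {e A B : ℝ → ℂ} (he : Continuous e) (hA : Continuous A)
    (hB : Continuous B) (he1 : ∀ θ, ‖e θ‖ = 1) {δ : ℝ} (hδ : 0 < δ) (hAδ : ∀ θ, δ ≤ (A θ).re)
    (hBδ : ∀ θ, δ ≤ (B θ).re) (x y : ℝ) :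
    ∫ θ in x..y, e θ * ∫ t : ℝ, Complex.exp (-(A θ * Complex.exp t + B θ * Complex.exp (-t))) =
      ∫ t : ℝ, ∫ θ in x..y,
        e θ * Complex.exp (-(A θ * Complex.exp t + B θ * Complex.exp (-t))) := by
  simp_rw [← integral_const_mul]
  refine intervalIntegral_integral_swap ?_
  have : IsFiniteMeasure (volume.restrict (Set.uIoc x y)) := ⟨by simp [Set.uIoc]⟩
  refine ((integrable_exp_mul_sub_exp_add_exp_neg 0 hδ).comp_snd _).mono' ?_
    (.of_forall fun ⟨θ, t⟩ => ?_)
  · refine Continuous.aestronglyMeasurable ?_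
    simp only [Function.uncurry_def]
    fun_prop
  · simp only [Function.uncurry_apply_pair, norm_mul, he1, one_mul]
    exact norm_cexp_neg_mul_exp_add_le (hAδ θ) (hBδ θ) t

lemma integral_exp_neg_mul_cosh_sub (ν : ℝ) {b : ℝ} (hb : 0 < b) :
    ∫ t : ℝ, Real.exp (-b * Real.cosh t - ν * t) = 2 * besselK ν b := by
  have hint (r : ℝ) : Integrable fun t : ℝ => Real.exp (-b * Real.cosh t - r * t) := by
    convert integrable_exp_mul_sub_exp_add_exp_neg (-r) (half_pos hb) using 3 with t
    rw [Real.cosh_eq]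
    ring
  have hneg : ∫ t : ℝ, Real.exp (-b * Real.cosh t - -ν * t) =
      ∫ t : ℝ, Real.exp (-b * Real.cosh t - ν * t) := by
    rw [← integral_neg_eq_self]
    simp
  have hadd : ∫ t : ℝ, Real.exp (-b * Real.cosh |t|) * Real.cosh (ν * |t|) =
      1 / 2 * ((∫ t : ℝ, Real.exp (-b * Real.cosh t - ν * t)) +
        ∫ t : ℝ, Real.exp (-b * Real.cosh t - -ν * t)) := by
    rw [← integral_add (hint ν) (hint (-ν)), ← integral_const_mul]
    congr 1 with t
    have h1 : Real.cosh (ν * |t|) = Real.cosh (ν * t) := by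
      rcases abs_choice t with h | h <;> simp [h]
    rw [Real.cosh_abs, h1, Real.cosh_eq (ν * t), sub_eq_add_neg, sub_eq_add_neg, Real.exp_add,
      Real.exp_add]
    ring_nf
  rw [integral_comp_abs (f := fun t => Real.exp (-b * Real.cosh t) * Real.cosh (ν * t)), hneg]
    at hadd
  rw [besselK, hadd]
  ring

lemma setIntegral_Ioi_eq_integral_comp_exp (f : ℝ → ℝ) :
    ∫ x in Set.Ioi (0:ℝ), x⁻¹ * f x = ∫ t : ℝ, f (Real.exp t) := by
  rw [← Real.range_exp, ← Set.image_univ, integral_image_eq_integral_abs_deriv_smul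
    MeasurableSet.univ (fun t _ => (Real.hasDerivAt_exp t).hasDerivWithinAt)
    Real.exp_injective.injOn, setIntegral_univ]
  congr 1 with t
  rw [smul_eq_mul, abs_of_pos (Real.exp_pos t), mul_inv_cancel_left₀ (Real.exp_ne_zero t)]

/-- The integral formula in terms of the two Bessel arguments `a` and `b`. -/
lemma integral_exp_mul_besselJ_comp_exp (m : ℤ) {p q γ a b : ℝ} (hp : 0 < p) (hq : 0 < q)
    (ha : 0 ≤ a) (hab : a < b) (h₁ : 4 * p * q = b ^ 2 - a ^ 2) (h₂ : 2 * p * γ = a * b) :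
    ∫ t : ℝ, Real.exp (-q * Real.exp t - p / Real.exp t) * besselJ m (γ * Real.exp t) =
      2 * besselJ m a * besselK m b := by
  have hb : 0 < b := ha.trans_lt hab
  have hpi : (Real.pi : ℂ) ≠ 0 := by exact_mod_cast Real.pi_ne_zero
  let e : ℝ → ℂ := fun θ => Complex.exp ((m * θ : ℝ) * Complex.I)
  have he : Continuous e := by fun_prop
  have he1 (θ : ℝ) : ‖e θ‖ = 1 := Complex.norm_exp_ofReal_mul_I _
  let A : ℝ → ℂ := fun θ => q + γ * Real.sin θ * Complex.I
  let C : ℝ → ℂ := fun θ => (b + a * Complex.exp (θ * Complex.I)) / 2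
  let D : ℝ → ℂ := fun θ => (b - a * Complex.exp ((-θ : ℝ) * Complex.I)) / 2
  have hAre (θ : ℝ) : (A θ).re = q := by simp [A]
  have hCre (θ : ℝ) : (b - a) / 2 ≤ (C θ).re := by
    have : (C θ).re = (b + a * Real.cos θ) / 2 := by
      simp [C, Complex.exp_ofReal_mul_I_re]
    rw [this]
    nlinarith [Real.neg_one_le_cos θ]
  have hDre (θ : ℝ) : (b - a) / 2 ≤ (D θ).re := by
    have : (D θ).re = (b - a * Real.cos (-θ)) / 2 := by
      simp only [D, Complex.div_ofNat_re, Complex.sub_re, Complex.re_ofReal_mul,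
        Complex.exp_ofReal_mul_I_re, Complex.ofReal_re]
    rw [this]
    nlinarith [Real.cos_le_one (-θ)]
  have hδ : 0 < (b - a) / 2 := by linarith
  have hprod (θ : ℝ) : A θ * p = C θ * D θ := by
    have e0 : Complex.exp (θ * Complex.I) * Complex.exp (-θ * Complex.I) = 1 := by
      rw [← Complex.exp_add]; simp
    have h₁' : 4 * (p : ℂ) * q = b ^ 2 - a ^ 2 := by exact_mod_cast h₁
    have h₂' : 2 * (p : ℂ) * γ = a * b := by exact_mod_cast h₂
    simp only [A, C, D, Complex.ofReal_sin, Complex.sin, Complex.ofReal_neg]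
    linear_combination h₁' / 4 + a ^ 2 / 4 * e0 + (Complex.exp (θ * Complex.I) -
      Complex.exp (-θ * Complex.I)) / 4 * h₂' + p * γ / 2 * (Complex.exp (-θ * Complex.I) -
      Complex.exp (θ * Complex.I)) * Complex.I_sq
  have key : ∫ t : ℝ, ∫ θ in -Real.pi..Real.pi,
        e θ * Complex.exp (-(A θ * Complex.exp t + p * Complex.exp (-t))) =
      ∫ t : ℝ, ∫ θ in -Real.pi..Real.pi,
        e θ * Complex.exp (-(C θ * Complex.exp t + D θ * Complex.exp (-t))) := by
    rw [← integral_mul_integral_cexp_swap (B := fun _ => (p : ℂ)) he (by fun_prop)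
      (by fun_prop) he1 (lt_min hp hq) (fun θ => (min_le_right _ _).trans (hAre θ).ge)
      (fun θ => by simp), ← integral_mul_integral_cexp_swap he (by fun_prop) (by fun_prop) he1 hδ
      hCre hDre]
    refine intervalIntegral.integral_congr fun θ _ => ?_
    rw [integral_cexp_neg_mul_exp_add_congr (by rwa [hAre]) (by simpa) (hδ.trans_le (hCre θ))
      (hδ.trans_le (hDre θ)) (hprod θ)]
  have hleft (t : ℝ) : ∫ θ in -Real.pi..Real.pi,
        e θ * Complex.exp (-(A θ * Complex.exp t + p * Complex.exp (-t))) =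
      2 * Real.pi * ((Real.exp (-q * Real.exp t - p / Real.exp t) *
        besselJ m (γ * Real.exp t) : ℝ) : ℂ) := by
    rw [Complex.ofReal_mul, ofReal_besselJ, mul_left_comm, ← mul_assoc (2 * (Real.pi : ℂ)),
      mul_one_div_cancel (mul_ne_zero two_ne_zero hpi), one_mul,
      ← intervalIntegral.integral_const_mul]
    refine intervalIntegral.integral_congr fun θ _ => ?_
    simp only [e, A]
    rw [Complex.ofReal_exp, ← Complex.exp_add, ← Complex.exp_add]
    congr 1
    push_cast
    rw [Complex.exp_neg]
    ring
  have hright (t : ℝ) : ∫ θ in -Real.pi..Real.pi,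
        e θ * Complex.exp (-(C θ * Complex.exp t + D θ * Complex.exp (-t))) =
      2 * Real.pi * ((besselJ m a * Real.exp (-b * Real.cosh t - m * t) : ℝ) : ℂ) := by
    rw [Complex.ofReal_mul, ← mul_assoc, ← integral_cexp_sub_mul_sinh m a t,
      ← intervalIntegral.integral_mul_const]
    refine intervalIntegral.integral_congr fun θ _ => ?_
    simp only [e, C, D]
    rw [Complex.ofReal_exp, ← Complex.exp_add, ← Complex.exp_add]
    congr 1
    push_cast
    rw [Complex.cosh, neg_add (t : ℂ), Complex.exp_add, Complex.exp_add, neg_mul]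
    ring
  simp_rw [hleft, hright] at key
  rw [integral_const_mul, integral_const_mul, integral_complex_ofReal, integral_complex_ofReal]
    at key
  have key' := mul_left_cancel₀ (mul_ne_zero two_ne_zero hpi) key
  rw [Complex.ofReal_inj.1 key', integral_const_mul, integral_exp_neg_mul_cosh_sub _ hb]
  ring

theorem stmt14 (m : ℕ) (p q γ : ℝ) (hp : 0 < p) (hq : 0 < q) (hγ : 0 < γ) :
    ∫ x in Set.Ioi (0:ℝ), x⁻¹ * Real.exp (-q * x - p / x) * besselJ (m : ℤ) (γ * x) =
      2 * besselJ (m : ℤ) (Real.sqrt (2 * p) * Real.sqrt (Real.sqrt (q ^ 2 + γ ^ 2) - q)) *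
        besselK (m : ℝ) (Real.sqrt (2 * p) * Real.sqrt (Real.sqrt (q ^ 2 + γ ^ 2) + q)) := by
  have hr : Real.sqrt (q ^ 2 + γ ^ 2) ^ 2 = q ^ 2 + γ ^ 2 := Real.sq_sqrt (by positivity)
  set r := Real.sqrt (q ^ 2 + γ ^ 2)
  have hqr : q ≤ r := Real.le_sqrt_of_sq_le (by nlinarith)
  have h2p : Real.sqrt (2 * p) ^ 2 = 2 * p := Real.sq_sqrt (by positivity)
  have hm : Real.sqrt (r - q) ^ 2 = r - q := Real.sq_sqrt (by linarith)
  have hpl : Real.sqrt (r + q) ^ 2 = r + q := Real.sq_sqrt (by linarith)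
  have hmul : Real.sqrt (r - q) * Real.sqrt (r + q) = γ := by
    rw [← Real.sqrt_mul (by linarith), show (r - q) * (r + q) = γ ^ 2 by linear_combination hr,
      Real.sqrt_sq hγ.le]
  simp_rw [mul_assoc _⁻¹]
  rw [setIntegral_Ioi_eq_integral_comp_exp
    (fun x => Real.exp (-q * x - p / x) * besselJ (m : ℤ) (γ * x))]
  have h := integral_exp_mul_besselJ_comp_exp m (γ := γ) hp hq
    (a := Real.sqrt (2 * p) * Real.sqrt (r - q)) (b := Real.sqrt (2 * p) * Real.sqrt (r + q))
    (by positivity)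
    (mul_lt_mul_of_pos_left (Real.sqrt_lt_sqrt (by linarith) (by linarith))
      (Real.sqrt_pos.2 (by positivity)))
    (by rw [mul_pow, mul_pow, h2p, hm, hpl]; ring)
    (by linear_combination -γ * h2p - Real.sqrt (2 * p) ^ 2 * hmul)
  rwa [Int.cast_natCast] at h
end

section
/- Let α > 0 and p > 0. Then ζ_p(α) = (2 p^{α/2} / Γ(α)) ∑_{n≥1} K_α(2√(np)) / n^{α/2}, i.e. the p-extended Riemann zeta function has a Schlömilch-series representation in terms of modified Bessel functions of the second kind. -/
open Real MeasureTheory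

/-- The integrand of the Laplace-type integral representing `besselK` is integrable. -/
theorem integrableOn_rpow_mul_exp_neg_div_mul_exp_neg_mul {α p c : ℝ} (hα : 0 < α) (hp : 0 < p)
    (hc : 0 < c) :
    IntegrableOn (fun t : ℝ => t ^ (α - 1) * Real.exp (-p / t) * Real.exp (-c * t))
      (Set.Ioi 0) := by
  have h := integrableOn_rpow_mul_exp_neg_mul_rpow (p := 1) (s := α - 1) (b := c)
    (by linarith) one_pos hc
  refine Integrable.mono' h (by fun_prop) ?_
  refine (ae_restrict_iff' measurableSet_Ioi).2 (Filter.Eventually.of_forall fun t ht => ?_)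
  have ht : 0 < t := ht
  rw [Real.norm_of_nonneg (by positivity), Real.rpow_one]
  have h1 : Real.exp (-p / t) ≤ 1 :=
    Real.exp_le_one_iff.2 (div_nonpos_of_nonpos_of_nonneg (by linarith) ht.le)
  gcongr
  exact mul_le_of_le_one_right (by positivity) h1

/-- An integrable function over the line integrates to the integral of its symmetrization
over the positive half-line. -/
theorem integral_eq_integral_Ioi_add_comp_neg {f : ℝ → ℝ} (hf : Integrable f) :
    ∫ u, f u = ∫ u in Set.Ioi (0 : ℝ), (f u + f (-u)) := by
  rw [integral_add hf.integrableOn hf.comp_neg.integrableOn, integral_comp_neg_Ioi, neg_zero,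
    add_comm, ← Set.compl_Ioi, add_comm, integral_add_compl measurableSet_Ioi hf]

/-- Laplace-type integral representation of the modified Bessel function of the second kind. -/
theorem integral_rpow_mul_exp_neg_div_mul_exp_neg_mul {α p c : ℝ} (hα : 0 < α) (hp : 0 < p)
    (hc : 0 < c) :
    ∫ t in Set.Ioi (0 : ℝ), t ^ (α - 1) * Real.exp (-p / t) * Real.exp (-c * t) =
      2 * p ^ (α / 2) * (besselK α (2 * Real.sqrt (c * p)) / c ^ (α / 2)) := by
  set s : ℝ := Real.sqrt p / Real.sqrt c with hs
  have hsp : 0 < Real.sqrt p := Real.sqrt_pos.2 hp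
  have hsc : 0 < Real.sqrt c := Real.sqrt_pos.2 hc
  have hs0 : 0 < s := div_pos hsp hsc
  have himg : (fun u : ℝ => s * Real.exp u) '' Set.univ = Set.Ioi 0 := by
    ext t
    constructor
    · rintro ⟨u, -, rfl⟩
      exact mul_pos hs0 (Real.exp_pos u)
    · intro ht
      refine ⟨Real.log (t / s), trivial, ?_⟩
      simp only [Real.exp_log (div_pos (Set.mem_Ioi.1 ht) hs0)]
      field_simp
  have hder : ∀ u ∈ (Set.univ : Set ℝ),
      HasDerivWithinAt (fun u : ℝ => s * Real.exp u) (s * Real.exp u) Set.univ u :=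
    fun u _ => ((Real.hasDerivAt_exp u).const_mul s).hasDerivWithinAt
  have hinj : Set.InjOn (fun u : ℝ => s * Real.exp u) Set.univ :=
    fun u _ v _ h => Real.exp_injective (mul_left_cancel₀ hs0.ne' h)
  have hpow : s ^ α = p ^ (α / 2) / c ^ (α / 2) := by
    rw [hs, Real.div_rpow hsp.le hsc.le, Real.sqrt_eq_rpow, Real.sqrt_eq_rpow,
      ← Real.rpow_mul hp.le, ← Real.rpow_mul hc.le, one_div_mul_eq_div]
  have hsub : ∀ u : ℝ, |s * Real.exp u| • ((s * Real.exp u) ^ (α - 1) *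
      Real.exp (-p / (s * Real.exp u)) * Real.exp (-c * (s * Real.exp u))) =
      s ^ α * (Real.exp (α * u) * Real.exp (-(2 * Real.sqrt (c * p)) * Real.cosh u)) := by
    intro u
    have hpos : 0 < s * Real.exp u := mul_pos hs0 (Real.exp_pos u)
    have h1 : p / (s * Real.exp u) = Real.sqrt (c * p) * Real.exp (-u) := by
      rw [hs, Real.exp_neg, Real.sqrt_mul hc.le]
      field_simp
      rw [Real.sq_sqrt hp.le]
    have h2 : c * (s * Real.exp u) = Real.sqrt (c * p) * Real.exp u := by
      rw [hs, Real.sqrt_mul hc.le]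
      field_simp
      rw [Real.sq_sqrt hc.le]
    rw [smul_eq_mul, abs_of_pos hpos, Real.rpow_sub_one hpos.ne', neg_div, neg_mul c, h1, h2,
      Real.mul_rpow hs0.le (Real.exp_pos u).le, ← Real.exp_mul, Real.cosh_eq, mul_comm u α]
    have h3 : Real.exp (-(2 * Real.sqrt (c * p)) * ((Real.exp u + Real.exp (-u)) / 2)) =
        Real.exp (-(Real.sqrt (c * p) * Real.exp (-u))) *
          Real.exp (-(Real.sqrt (c * p) * Real.exp u)) := by
      rw [← Real.exp_add]
      ring_nf
    rw [h3]
    field_simp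
  have hint := integrableOn_rpow_mul_exp_neg_div_mul_exp_neg_mul hα hp hc
  rw [← himg, integrableOn_image_iff_integrableOn_abs_deriv_smul MeasurableSet.univ hder hinj,
    integrableOn_univ] at hint
  simp only [hsub] at hint
  rw [← himg, integral_image_eq_integral_abs_deriv_smul MeasurableSet.univ hder hinj,
    Measure.restrict_univ]
  simp only [hsub]
  rw [integral_eq_integral_Ioi_add_comp_neg hint, hpow]
  have hsym : ∀ u : ℝ,
      p ^ (α / 2) / c ^ (α / 2) *
          (Real.exp (α * u) * Real.exp (-(2 * Real.sqrt (c * p)) * Real.cosh u)) +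
        p ^ (α / 2) / c ^ (α / 2) *
          (Real.exp (α * -u) * Real.exp (-(2 * Real.sqrt (c * p)) * Real.cosh (-u))) =
      2 * (p ^ (α / 2) / c ^ (α / 2)) *
        (Real.exp (-(2 * Real.sqrt (c * p)) * Real.cosh u) * Real.cosh (α * u)) := by
    intro u
    rw [Real.cosh_neg, Real.cosh_eq (α * u), mul_neg]
    ring
  simp only [hsym]
  rw [integral_const_mul, besselK]
  ring

/-- The expansion of `1 / (exp t - 1)` as a geometric series. -/
theorem hasSum_exp_neg_succ_mul {t : ℝ} (ht : 0 < t) :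
    HasSum (fun n : ℕ => Real.exp (-((n : ℝ) + 1) * t)) (Real.exp t - 1)⁻¹ := by
  have h := (hasSum_geometric_of_lt_one (Real.exp_pos (-t)).le
    (Real.exp_lt_one_iff.2 (neg_lt_zero.2 ht))).mul_left (Real.exp (-t))
  have h1 : 1 < Real.exp t := Real.one_lt_exp_iff.2 ht
  have h2 : Real.exp t - 1 ≠ 0 := by linarith
  have h3 : Real.exp (-t) * (1 - Real.exp (-t))⁻¹ = (Real.exp t - 1)⁻¹ := by
    rw [Real.exp_neg]
    field_simp
  rw [h3] at h
  refine h.congr_fun fun n => ?_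
  rw [← Real.exp_nat_mul, ← Real.exp_add]
  ring_nf

/-- The integral of a pointwise convergent series of nonnegative integrable functions is the sum
of the integrals. -/
theorem integral_eq_tsum_integral_of_nonneg {X : Type*} [MeasurableSpace X] {μ : Measure X}
    {f : ℕ → X → ℝ} {g : X → ℝ} (hf : ∀ n, Integrable (f n) μ)
    (hf0 : ∀ n, 0 ≤ᵐ[μ] f n) (hg : AEStronglyMeasurable g μ)
    (h : ∀ᵐ x ∂μ, HasSum (fun n => f n x) (g x)) :
    ∫ x, g x ∂μ = ∑' n, ∫ x, f n x ∂μ := by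
  have hf0' : ∀ᵐ x ∂μ, ∀ n, 0 ≤ f n x := ae_all_iff.2 hf0
  have hg0 : 0 ≤ᵐ[μ] g := by
    filter_upwards [hf0', h] with x h0 hx using hx.nonneg h0
  rw [integral_eq_lintegral_of_nonneg_ae hg0 hg]
  have hsum : ∫⁻ x, ENNReal.ofReal (g x) ∂μ = ∑' n, ∫⁻ x, ENNReal.ofReal (f n x) ∂μ := by
    rw [← lintegral_tsum fun n => (hf n).aestronglyMeasurable.aemeasurable.ennreal_ofReal]
    refine lintegral_congr_ae ?_
    filter_upwards [hf0', h] with x h0 hx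
    rw [← hx.tsum_eq, ENNReal.ofReal_tsum_of_nonneg h0 hx.summable]
  rw [hsum, ENNReal.tsum_toReal_eq fun n => (hf n).lintegral_lt_top.ne]
  exact tsum_congr fun n =>
    (integral_eq_lintegral_of_nonneg_ae (hf0 n) (hf n).aestronglyMeasurable).symm

theorem stmt15 (α p : ℝ) (hα : 0 < α) (hp : 0 < p) :
    zetaP p α =
      (2 * p ^ (α / 2) / Real.Gamma α) *
        ∑' n : ℕ, besselK α (2 * Real.sqrt (((n : ℝ) + 1) * p)) / ((n : ℝ) + 1) ^ (α / 2) := by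
  have hn : ∀ n : ℕ, (0 : ℝ) < (n : ℝ) + 1 := fun n => n.cast_add_one_pos
  have key : ∫ t in Set.Ioi (0 : ℝ), t ^ (α - 1) * Real.exp (-p / t) / (Real.exp t - 1) =
      ∑' n : ℕ, ∫ t in Set.Ioi (0 : ℝ),
        t ^ (α - 1) * Real.exp (-p / t) * Real.exp (-((n : ℝ) + 1) * t) := by
    refine integral_eq_tsum_integral_of_nonneg
      (fun n => integrableOn_rpow_mul_exp_neg_div_mul_exp_neg_mul hα hp (hn n)) (fun n => ?_)
      (Measurable.aestronglyMeasurable (by fun_prop)) ?_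
    · filter_upwards [ae_restrict_mem measurableSet_Ioi] with t ht
      have ht : 0 < t := ht
      simp only [Pi.zero_apply]
      positivity
    · filter_upwards [ae_restrict_mem measurableSet_Ioi] with t ht
      exact (hasSum_exp_neg_succ_mul ht).mul_left _
  rw [zetaP, key]
  simp only [fun n : ℕ => integral_rpow_mul_exp_neg_div_mul_exp_neg_mul hα hp (hn n)]
  rw [tsum_mul_left]
  ring
end

section
/- Let p > 0, μ ≥ −1/2 and |r| < 1. Then the series defining the p-extended Mathieu series converges absolutely, i.e. the family ((−1)^n (Γ(μ+n+1)/(n! Γ(μ+1))) ζ_p(2μ+2n+1) r^{2n})_{n≥0} is absolutely summable. -/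
open Real MeasureTheory

/-- The `p`-extended zeta function is bounded on the half-line `0 ≤ α`. -/
lemma abs_zetaP_le {p α : ℝ} (hp : 0 < p) (hα : 0 ≤ α) : |zetaP p α| ≤ 1 + 1 / p := by
  rcases hα.eq_or_lt with rfl | hα
  · simp only [zetaP, Real.Gamma_zero, div_zero, zero_mul, abs_zero]
    positivity
  have hΓ : 0 < Real.Gamma α := Real.Gamma_pos_of_pos hα
  have hint : IntegrableOn (fun t : ℝ => (1 + 1 / p) * (Real.exp (-t) * t ^ (α - 1)))
      (Set.Ioi 0) := (Real.GammaIntegral_convergent hα).const_mul _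
  have hnonneg : ∀ t ∈ Set.Ioi (0 : ℝ),
      0 ≤ t ^ (α - 1) * Real.exp (-p / t) / (Real.exp t - 1) := by
    intro t ht
    have ht : 0 < t := ht
    have : 0 < Real.exp t - 1 := sub_pos.2 (Real.one_lt_exp_iff.2 ht)
    positivity
  have hle : ∀ t ∈ Set.Ioi (0 : ℝ), t ^ (α - 1) * Real.exp (-p / t) / (Real.exp t - 1) ≤
      (1 + 1 / p) * (Real.exp (-t) * t ^ (α - 1)) := by
    intro t ht
    have ht : 0 < t := ht
    have h1 : t ≤ Real.exp t - 1 := by linarith [Real.add_one_le_exp t]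
    have hpos : 0 < Real.exp t - 1 := ht.trans_le h1
    have hle_one : Real.exp (-p / t) ≤ 1 :=
      Real.exp_le_one_iff.2 (div_nonpos_of_nonpos_of_nonneg (by linarith) ht.le)
    have hle_div : Real.exp (-p / t) ≤ t / p := by
      have h : p / t ≤ Real.exp (p / t) := by linarith [Real.add_one_le_exp (p / t)]
      rw [neg_div, Real.exp_neg, ← inv_div p t]
      exact inv_anti₀ (by positivity) h
    have key : Real.exp (-p / t) / (Real.exp t - 1) ≤ (1 + 1 / p) * Real.exp (-t) := by
      have hsplit : Real.exp (-p / t) / (Real.exp t - 1) =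
          (Real.exp (-p / t) + Real.exp (-p / t) / (Real.exp t - 1)) * Real.exp (-t) := by
        rw [Real.exp_neg t]
        field_simp
        ring
      rw [hsplit]
      refine mul_le_mul_of_nonneg_right (add_le_add hle_one ?_) (Real.exp_pos _).le
      calc Real.exp (-p / t) / (Real.exp t - 1) ≤ (t / p) / t := by gcongr
        _ = 1 / p := by field_simp
    calc t ^ (α - 1) * Real.exp (-p / t) / (Real.exp t - 1)
        = t ^ (α - 1) * (Real.exp (-p / t) / (Real.exp t - 1)) := by ring
      _ ≤ t ^ (α - 1) * ((1 + 1 / p) * Real.exp (-t)) := by gcongr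
      _ = _ := by ring
  have hbound : ∫ t in Set.Ioi (0 : ℝ), t ^ (α - 1) * Real.exp (-p / t) / (Real.exp t - 1) ≤
      (1 + 1 / p) * Real.Gamma α := by
    rw [Real.Gamma_eq_integral hα, ← integral_const_mul]
    exact integral_mono_of_nonneg (ae_restrict_of_forall_mem measurableSet_Ioi hnonneg) hint
      (ae_restrict_of_forall_mem measurableSet_Ioi hle)
  have hI := setIntegral_nonneg (μ := volume) measurableSet_Ioi hnonneg
  rw [zetaP, abs_of_nonneg (by positivity), one_div, inv_mul_le_iff₀ hΓ, mul_comm]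
  exact hbound

/-- The binomial series with coefficients `Γ(μ + n + 1) / (n! Γ(μ + 1))` converges on `[0, 1)`. -/
lemma summable_Gamma_div_factorial_mul_pow {μ x : ℝ} (hμ : -1 < μ) (hx : 0 ≤ x) (hx1 : x < 1) :
    Summable fun n : ℕ =>
      Real.Gamma (μ + n + 1) / (n.factorial * Real.Gamma (μ + 1)) * x ^ n := by
  have hpos (n : ℕ) : 0 < μ + n + 1 := by linarith [n.cast_nonneg (α := ℝ)]
  have hΓ : 0 < Real.Gamma (μ + 1) := Real.Gamma_pos_of_pos (by linarith)
  have hlim : Filter.Tendsto (fun n : ℕ => (1 + μ / ((n : ℝ) + 1)) * x) Filter.atTop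
      (nhds ((1 + 0) * x)) := by
    refine Filter.Tendsto.mul_const _ (tendsto_const_nhds.add ?_)
    exact tendsto_const_nhds.div_atTop
      (Filter.tendsto_atTop_add_const_right _ _ tendsto_natCast_atTop_atTop)
  refine summable_of_ratio_norm_eventually_le (r := (x + 1) / 2) (by linarith) ?_
  filter_upwards [hlim.eventually_le_const (u := (x + 1) / 2) (by linarith)] with n hn
  have hΓn : 0 < Real.Gamma (μ + n + 1) := Real.Gamma_pos_of_pos (hpos n)
  have hrec : Real.Gamma (μ + (n + 1 : ℕ) + 1) / ((n + 1).factorial * Real.Gamma (μ + 1)) *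
        x ^ (n + 1) = (1 + μ / ((n : ℝ) + 1)) * x *
      (Real.Gamma (μ + n + 1) / (n.factorial * Real.Gamma (μ + 1)) * x ^ n) := by
    rw [show μ + (n + 1 : ℕ) + 1 = (μ + n + 1) + 1 by push_cast; ring,
      Real.Gamma_add_one (hpos n).ne', Nat.factorial_succ]
    push_cast
    field_simp
    ring
  have hcoef : 0 ≤ 1 + μ / ((n : ℝ) + 1) := by
    rw [one_add_div (by positivity)]
    exact div_nonneg (by linarith [hpos n]) (by positivity)
  rw [hrec, norm_mul, Real.norm_of_nonneg (mul_nonneg hcoef hx)]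
  gcongr

theorem stmt17 (p μ r : ℝ) (hp : 0 < p) (hμ : -(1/2) ≤ μ) (hr : |r| < 1) :
    Summable fun n : ℕ =>
      |(-1 : ℝ) ^ n * (Real.Gamma (μ + n + 1) / (n.factorial * Real.Gamma (μ + 1))) *
        zetaP p (2 * μ + 2 * n + 1) * r ^ (2 * n)| := by
  have hsum := (summable_Gamma_div_factorial_mul_pow (μ := μ) (by linarith) (sq_nonneg r)
    ((sq_lt_one_iff_abs_lt_one r).2 hr)).mul_left (1 + 1 / p)
  refine Summable.of_nonneg_of_le (fun _ => abs_nonneg _) (fun n => ?_) hsum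
  have hn : (0 : ℝ) ≤ n := n.cast_nonneg
  have hcoef : 0 ≤ Real.Gamma (μ + n + 1) / (n.factorial * Real.Gamma (μ + 1)) :=
    div_nonneg (Real.Gamma_nonneg_of_nonneg (by linarith))
      (mul_nonneg (by positivity) (Real.Gamma_nonneg_of_nonneg (by linarith)))
  have hz := abs_zetaP_le (α := 2 * μ + 2 * n + 1) hp (by linarith)
  rw [abs_mul, abs_mul, abs_mul, abs_pow, abs_neg, abs_one, one_pow, one_mul,
    abs_of_nonneg hcoef, pow_mul, abs_of_nonneg (pow_nonneg (sq_nonneg r) n),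
    mul_comm _ |zetaP _ _|, mul_assoc]
  gcongr
end

section
/- Let p > 0, 0 < γ < 1 and let n ≥ 1 be an integer. Then ∫_0^∞ x^{n−1} e^{−p/x} (e^x − 1)^{−1} J_{n−2}(γx) dx = ((2γ)^{n−2} Γ(n − 1/2) / √π) · S_{n−3/2, p}(γ). -/
open Real MeasureTheory

/-- The coefficients `c` for which `besselJ m x = ∑ j, x ^ j / j! * c j`. -/
noncomputable def besselCoeff (m : ℤ) (j : ℕ) : ℝ :=
  (1 / π) * ∫ θ in (0:ℝ)..π, cos ((m : ℝ) * θ - j * (π / 2)) * sin θ ^ j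

theorem hasSum_cos_sub (u y : ℝ) :
    HasSum (fun j : ℕ => y ^ j / j.factorial * cos (u - j * (π / 2))) (cos (u - y)) := by
  have h := (NormedSpace.expSeries_div_hasSum_exp (Complex.I * y)).mul_left
    (Complex.exp (-(Complex.I * u)))
  rw [← Complex.exp_eq_exp_ℂ, ← Complex.exp_add] at h
  have h2 := Complex.hasSum_re h
  convert h2 using 1
  · funext j
    have hI : Complex.I ^ j = Complex.exp (j * (π / 2 * Complex.I)) := by
      rw [Complex.exp_nat_mul, Complex.exp_pi_div_two_mul_I]
    have : Complex.exp (-(Complex.I * u)) * ((Complex.I * y) ^ j / j.factorial) =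
        ((y ^ j / j.factorial : ℝ) : ℂ) *
          Complex.exp (((j * (π / 2) - u : ℝ) : ℂ) * Complex.I) := by
      rw [mul_pow, hI]
      push_cast
      rw [sub_mul, Complex.exp_sub, Complex.exp_neg]
      ring_nf
    rw [this, Complex.re_ofReal_mul, Complex.exp_ofReal_mul_I_re, ← cos_neg, neg_sub]
  · have : -(Complex.I * u) + Complex.I * y = ((y - u : ℝ) : ℂ) * Complex.I := by
      push_cast; ring
    rw [this, Complex.exp_ofReal_mul_I_re, ← cos_neg, neg_sub]

theorem hasSum_besselJ (m : ℤ) (x : ℝ) :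
    HasSum (fun j : ℕ => x ^ j / j.factorial * besselCoeff m j) (besselJ m x) := by
  have h : HasSum (fun j : ℕ => ∫ θ in (0:ℝ)..π,
        (x * sin θ) ^ j / j.factorial * cos ((m : ℝ) * θ - j * (π / 2)))
      (∫ θ in (0:ℝ)..π, cos ((m : ℝ) * θ - x * sin θ)) := by
    refine intervalIntegral.hasSum_integral_of_dominated_convergence
      (fun j _ => |x| ^ j / j.factorial) (fun j => ?_) (fun j => ?_) ?_ ?_ ?_
    · exact Continuous.aestronglyMeasurable (by fun_prop)
    · refine Filter.Eventually.of_forall fun θ _ => ?_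
      rw [norm_mul, norm_div, norm_pow, norm_mul, Real.norm_natCast]
      simp only [Real.norm_eq_abs]
      refine (mul_le_of_le_one_right (by positivity) (abs_cos_le_one _)).trans ?_
      gcongr
      exact mul_le_of_le_one_right (abs_nonneg _) (abs_sin_le_one _)
    · exact Filter.Eventually.of_forall fun θ _ => Real.summable_pow_div_factorial _
    · exact intervalIntegrable_const
    · exact Filter.Eventually.of_forall fun θ _ => hasSum_cos_sub _ _
  rw [besselJ]
  convert! h.mul_left (1 / π) using 1
  funext j
  rw [besselCoeff, mul_left_comm, ← intervalIntegral.integral_const_mul]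
  congr 2
  funext θ
  rw [mul_pow]
  ring

theorem abs_besselCoeff_le_one (m : ℤ) (j : ℕ) : |besselCoeff m j| ≤ 1 := by
  have h : ‖∫ θ in (0:ℝ)..π, cos ((m : ℝ) * θ - j * (π / 2)) * sin θ ^ j‖ ≤ 1 * |π - 0| := by
    refine intervalIntegral.norm_integral_le_of_norm_le_const fun θ _ => ?_
    rw [norm_mul, norm_pow]
    exact mul_le_one₀ (abs_cos_le_one _) (by positivity)
      (pow_le_one₀ (norm_nonneg _) (abs_sin_le_one _))
  rw [one_mul, sub_zero, abs_of_pos pi_pos, Real.norm_eq_abs] at h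
  rw [besselCoeff, abs_mul, abs_of_pos (by positivity)]
  calc 1 / π * _ ≤ 1 / π * π := by gcongr
    _ = 1 := by field_simp

theorem besselCoeff_succ (m : ℤ) (j : ℕ) :
    besselCoeff m (j + 1) = (besselCoeff (m - 1) j - besselCoeff (m + 1) j) / 2 := by
  simp only [besselCoeff]
  rw [← mul_sub, ← intervalIntegral.integral_sub
    (Continuous.intervalIntegrable (by fun_prop) _ _)
    (Continuous.intervalIntegrable (by fun_prop) _ _), mul_div_assoc,
    ← intervalIntegral.integral_div]
  congr 2
  funext θ
  have h1 : (m : ℝ) * θ - ((j + 1 : ℕ) : ℝ) * (π / 2) = (m * θ - j * (π / 2)) - π / 2 := by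
    push_cast; ring
  have h2 : ((m - 1 : ℤ) : ℝ) * θ - (j : ℝ) * (π / 2) = (m * θ - j * (π / 2)) - θ := by
    push_cast; ring
  have h3 : ((m + 1 : ℤ) : ℝ) * θ - (j : ℝ) * (π / 2) = (m * θ - j * (π / 2)) + θ := by
    push_cast; ring
  rw [h1, h2, h3, cos_sub_pi_div_two, cos_sub, cos_add]
  ring

theorem besselCoeff_zero_zero : besselCoeff 0 0 = 1 := by
  simp [besselCoeff, pi_ne_zero]

theorem besselCoeff_zero_right {m : ℤ} (hm : m ≠ 0) : besselCoeff m 0 = 0 := by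
  have hm' : (m : ℝ) ≠ 0 := by exact_mod_cast hm
  simp [besselCoeff, intervalIntegral.integral_comp_mul_left (fun x => cos x) hm',
    sin_int_mul_pi]

theorem besselCoeff_eq_zero {m : ℤ} {j : ℕ} (h : (j : ℤ) < m ∨ ¬ (2 : ℤ) ∣ j - m) :
    besselCoeff m j = 0 := by
  induction j generalizing m with
  | zero => exact besselCoeff_zero_right (by rintro rfl; simp at h)
  | succ j ih =>
    rw [besselCoeff_succ, ih (by omega), ih (by omega)]
    simp

theorem besselCoeff_sub_two_mul (j i : ℕ) :
    besselCoeff (j - 2 * i) j = (-1) ^ i * j.choose i / 2 ^ j := by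
  induction j generalizing i with
  | zero =>
    cases i with
    | zero => simp [besselCoeff_zero_zero]
    | succ i => simpa using besselCoeff_zero_right (m := (0 : ℕ) - 2 * (i + 1 : ℕ)) (by omega)
  | succ j ih =>
    rw [besselCoeff_succ]
    have h1 : ((j + 1 : ℕ) : ℤ) - 2 * i - 1 = j - 2 * i := by push_cast; ring
    rw [h1, ih]
    cases i with
    | zero =>
      rw [besselCoeff_eq_zero (by left; push_cast; omega)]
      simp [pow_succ]
      ring
    | succ i =>
      have h2 : ((j + 1 : ℕ) : ℤ) - 2 * (i + 1 : ℕ) + 1 = j - 2 * i := by push_cast; ring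
      rw [h2, ih, Nat.choose_succ_succ]
      push_cast
      field_simp
      ring

theorem exp_neg_div_div_exp_sub_one_le {p x : ℝ} (hp : 0 < p) (hx : 0 < x) :
    exp (-p / x) / (exp x - 1) ≤ (1 + 1 / p) * exp (-x) := by
  have h1 : exp (-p / x) ≤ 1 :=
    exp_le_one_iff.2 (div_nonpos_of_nonpos_of_nonneg (by linarith) hx.le)
  have h2 : exp (-p / x) ≤ x / p := by
    have := add_one_le_exp (p / x)
    rw [neg_div, exp_neg, ← inv_div p x]
    exact inv_anti₀ (div_pos hp hx) (by linarith)
  have h3 : 0 < exp x - 1 := by linarith [add_one_lt_exp hx.ne']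
  have h4 : x * exp x ≤ (1 + x) * (exp x - 1) := by linarith [add_one_le_exp x]
  rw [div_le_iff₀ h3, exp_neg]
  have h5 : (1 + x) * exp (-p / x) ≤ (1 + 1 / p) * x := by
    have : x * exp (-p / x) ≤ x * 1 := by gcongr
    have h : (1 + 1 / p) * x = x / p + x * 1 := by ring
    linarith
  have h6 : exp (-p / x) ≤ (1 + 1 / p) * x / (1 + x) := by
    rw [le_div_iff₀ (by linarith)]; linarith
  have h7 : x / (1 + x) ≤ (exp x)⁻¹ * (exp x - 1) := by
    rw [div_le_iff₀ (by linarith), inv_mul_eq_div, div_mul_eq_mul_div, le_div_iff₀ (exp_pos x)]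
    linarith
  calc _ ≤ _ := h6
    _ = (1 + 1 / p) * (x / (1 + x)) := by ring
    _ ≤ (1 + 1 / p) * ((exp x)⁻¹ * (exp x - 1)) := by gcongr
    _ = _ := by ring

theorem rpow_mul_exp_div_le {p s x : ℝ} (hp : 0 < p) (hx : 0 < x) :
    ‖x ^ (s - 1) * exp (-p / x) / (exp x - 1)‖ ≤ (1 + 1 / p) * (exp (-x) * x ^ (s - 1)) := by
  have h3 : 0 < exp x - 1 := by linarith [add_one_lt_exp hx.ne']
  rw [Real.norm_of_nonneg (by positivity), mul_div_assoc]
  calc _ ≤ x ^ (s - 1) * ((1 + 1 / p) * exp (-x)) := by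
        gcongr
        exact exp_neg_div_div_exp_sub_one_le hp hx
    _ = _ := by ring

theorem integrableOn_rpow_mul_exp_div {p s : ℝ} (hp : 0 < p) (hs : 0 < s) :
    IntegrableOn (fun x : ℝ => x ^ (s - 1) * exp (-p / x) / (exp x - 1)) (Set.Ioi 0) := by
  refine Integrable.mono' ((GammaIntegral_convergent hs).const_mul (1 + 1 / p)) ?_ ?_
  · exact Measurable.aestronglyMeasurable (by fun_prop)
  · exact (ae_restrict_iff' measurableSet_Ioi).2
      (Filter.Eventually.of_forall fun x hx => rpow_mul_exp_div_le hp hx)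

theorem integral_norm_rpow_mul_exp_div_le {p s : ℝ} (hp : 0 < p) (hs : 0 < s) :
    ∫ x in Set.Ioi (0:ℝ), ‖x ^ (s - 1) * exp (-p / x) / (exp x - 1)‖ ≤
      (1 + 1 / p) * Gamma s := by
  rw [Gamma_eq_integral hs, ← integral_const_mul]
  exact setIntegral_mono_on (integrableOn_rpow_mul_exp_div hp hs).norm
    ((GammaIntegral_convergent hs).const_mul (1 + 1 / p)) measurableSet_Ioi
    fun x hx => rpow_mul_exp_div_le hp hx

theorem hasSum_integral_mul_besselJ {p γ : ℝ} (hp : 0 < p) (hγ0 : 0 < γ) (hγ1 : γ < 1)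
    {n : ℕ} (hn : 1 ≤ n) (m : ℤ) :
    HasSum (fun j : ℕ => γ ^ j / j.factorial * besselCoeff m j *
        ∫ x in Set.Ioi (0:ℝ), x ^ ((n + j : ℝ) - 1) * exp (-p / x) / (exp x - 1))
      (∫ x in Set.Ioi (0:ℝ),
        x ^ ((n : ℝ) - 1) * exp (-p / x) / (exp x - 1) * besselJ m (γ * x)) := by
  have hs (j : ℕ) : (0 : ℝ) < n + j := by positivity
  have hsum : Summable fun j : ℕ => ∫ x in Set.Ioi (0:ℝ), ‖γ ^ j / j.factorial * besselCoeff m j *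
      (x ^ ((n + j : ℝ) - 1) * exp (-p / x) / (exp x - 1))‖ := by
    refine Summable.of_nonneg_of_le (fun j => integral_nonneg fun x => norm_nonneg _)
      (fun j => ?_) ((summable_choose_mul_geometric_of_norm_lt_one (n - 1)
        (r := γ) (by rwa [Real.norm_of_nonneg hγ0.le])).mul_left
          ((1 + 1 / p) * (n - 1).factorial))
    simp only [norm_mul _ (_ / _), integral_const_mul]
    obtain ⟨a, rfl⟩ : ∃ a, n = a + 1 := ⟨n - 1, by omega⟩
    have hG : Gamma ((a + 1 : ℕ) + j : ℝ) = ((j + a).factorial : ℝ) := by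
      rw [← Gamma_nat_eq_factorial]
      push_cast
      ring_nf
    have hc : ‖γ ^ j / j.factorial * besselCoeff m j‖ ≤ γ ^ j / j.factorial := by
      rw [norm_mul, Real.norm_of_nonneg (by positivity)]
      exact mul_le_of_le_one_right (by positivity) (abs_besselCoeff_le_one m j)
    have hI := integral_norm_rpow_mul_exp_div_le hp (hs j)
    rw [hG] at hI
    calc _ ≤ γ ^ j / j.factorial * ((1 + 1 / p) * (j + a).factorial) := by gcongr
      _ = _ := by
        rw [← Nat.add_choose_mul_factorial_mul_factorial j a, Nat.add_sub_cancel]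
        push_cast
        field_simp
  have h := hasSum_integral_of_summable_integral_norm
    (fun j => (integrableOn_rpow_mul_exp_div hp (hs j)).const_mul _) hsum
  simp only [integral_const_mul] at h
  convert! h using 1
  refine setIntegral_congr_fun measurableSet_Ioi fun x hx => ?_
  rw [← ((hasSum_besselJ m (γ * x)).mul_left _).tsum_eq]
  congr 1
  funext j
  rw [add_sub_right_comm, rpow_add hx, rpow_natCast, mul_pow]
  ring

theorem stmt18 (p γ : ℝ) (hp : 0 < p) (hγ0 : 0 < γ) (hγ1 : γ < 1)
    (n : ℕ) (hn : 1 ≤ n) :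
    ∫ x in Set.Ioi (0:ℝ),
        x ^ ((n : ℝ) - 1) * Real.exp (-p / x) / (Real.exp x - 1) * besselJ ((n : ℤ) - 2) (γ * x) =
      ((2 * γ) ^ ((n : ℤ) - 2) * Real.Gamma ((n : ℝ) - 1/2) / Real.sqrt Real.pi) *
        mathieuS ((n : ℝ) - 3/2) p γ := by
  have h := hasSum_integral_mul_besselJ hp hγ0 hγ1 hn (n - 2)
  have he : Function.Injective fun k : ℕ => 2 * k + n - 2 := fun a b hab => by
    dsimp only at hab; omega
  rw [← he.hasSum_iff fun j hj => ?_] at h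
  · rw [← h.tsum_eq, mathieuS, ← mul_assoc, ← tsum_mul_left]
    congr 1
    funext k
    dsimp only [Function.comp]
    rcases Nat.lt_or_ge (k + n) 2 with hkn | hkn
    · obtain rfl : k = 0 := by omega
      obtain rfl : n = 1 := by omega
      have : besselCoeff (-1) 0 = 0 := besselCoeff_zero_right (by norm_num)
      norm_num [zetaP, this]
    · obtain ⟨N, hN⟩ := Nat.exists_eq_add_of_le hkn
      have hj : 2 * k + n - 2 = k + N := by omega
      have hm : (n : ℤ) - 2 = (k + N : ℕ) - 2 * k := by omega
      have hn' : (n : ℝ) = 2 + N - k := by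
        rw [eq_sub_iff_add_eq]
        exact_mod_cast (by omega : n + k = 2 + N)
      have h2γ : 2 * γ ≠ 0 := by positivity
      have hz : (2 * γ) ^ ((n : ℤ) - 2) = (2 * γ) ^ (k + N) / (2 * γ) ^ (2 * k) := by
        rw [hm, zpow_sub₀ h2γ, zpow_natCast]
        norm_cast
      have hL := Gamma_mul_Gamma_add_half (N + 1 : ℝ)
      have hα : (2 * ((n : ℝ) - 3 / 2) + 2 * k + 1) = 2 * (N + 1 : ℝ) := by rw [hn']; ring
      have hα' : (n : ℝ) + (k + N : ℕ) = 2 * (N + 1 : ℝ) := by rw [hn']; push_cast; ring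
      have hΓ : (n : ℝ) - 3 / 2 + k + 1 = N + 1 + 1 / 2 := by rw [hn']; ring
      have hΓ' : (n : ℝ) - 3 / 2 + 1 = n - 1 / 2 := by ring
      have hΓ0 : 0 < Gamma ((n : ℝ) - 1 / 2) := Gamma_pos_of_pos (by
        have : (1 : ℝ) ≤ n := by exact_mod_cast hn
        linarith)
      have hΓα : 0 < Gamma (2 * (N + 1 : ℝ)) := Gamma_pos_of_pos (by positivity)
      have h2 : (2 : ℝ) ^ (1 - 2 * (N + 1 : ℝ)) = 1 / (2 * 2 ^ (2 * N)) := by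
        rw [show 1 - 2 * (N + 1 : ℝ) = -((2 * N + 1 : ℕ) : ℝ) by push_cast; ring,
          rpow_neg zero_le_two, rpow_natCast, pow_succ', one_div]
      rw [h2, Gamma_nat_eq_factorial] at hL
      have hN0 : (0 : ℝ) < N.factorial := by positivity
      have hL' : Gamma (N + 1 + 1 / 2 : ℝ) =
          Gamma (2 * (N + 1 : ℝ)) * (1 / (2 * 2 ^ (2 * N))) * √π / N.factorial := by
        rw [eq_div_iff hN0.ne', ← hL, mul_comm]
      have hπ : 0 < √π := sqrt_pos.2 pi_pos
      have hch : (((k + N).factorial : ℕ) : ℝ) =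
          (k + N).choose k * k.factorial * N.factorial := by
        rw [Nat.choose_symm_add]
        exact_mod_cast (Nat.add_choose_mul_factorial_mul_factorial k N).symm
      have hc0 : (0 : ℝ) < (k + N).choose k := by
        exact_mod_cast Nat.choose_pos (Nat.le_add_right k N)
      rw [hj, zetaP, hα, hα', hΓ, hΓ', hz, hm, besselCoeff_sub_two_mul, hL', hch]
      generalize (∫ x in Set.Ioi (0:ℝ), (_ : ℝ)) = I
      generalize Gamma ((n : ℝ) - 1 / 2) = G at hΓ0 ⊢
      field_simp
      ring
  · rw [besselCoeff_eq_zero, mul_zero, zero_mul]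
    by_contra! hc
    obtain ⟨hc1, c, hc2⟩ := hc
    exact hj ⟨c.toNat, by dsimp only; omega⟩
end
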